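/- Let R be a commutative noetherian ring, let a be a proper ideal of R, and let M be a finitely generated R-module. Then cd(a, M) ≤ Σ_{p ∈ Min(a)} cd(p, M), where Min(a) denotes the (finite) set of minimal prime ideals over a. -/

import Mathlib

open CategoryTheory

/-- The cohomological dimension `cd(a, X) = sup {i | H^i_a(X) ≠ 0}` of an `R`-module `X`
with respect to an ideal `a`. -/
noncomputable def cohDim {R : Type} [CommRing R] (a : Ideal R) (X : ModuleCat R) : ℕ :=
  sSup {i : ℕ | Nontrivial ((localCohomology a i).obj X)}
/-- The vanishing of `H^i_a(N)`, in terms of elements of `Ext`. -/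
def LCVc {R : Type} [CommRing R] (a : Ideal R) (i : ℕ) (N : ModuleCat.{0} R) : Prop :=
  ∀ J : Ideal R, a ≤ J.radical → ∀ x : Abelian.Ext (ModuleCat.of R (R ⧸ J)) N i,
    ∃ (J' : Ideal R) (h : J' ≤ J), a ≤ J'.radical ∧
      (Abelian.Ext.mk₀ (ModuleCat.ofHom (Submodule.factor h))).comp x (zero_add i) = 0

/-- The vanishing of `H^i_a(N)`, for unbundled modules. -/
abbrev LCV {R : Type} [CommRing R] (a : Ideal R) (i : ℕ) (N : Type) [AddCommGroup N] [Module R N] :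
    Prop := LCVc a i (ModuleCat.of R N)

namespace LCV

variable {R : Type} [CommRing R]
variable {N₁ N₂ N₃ : Type} [AddCommGroup N₁] [Module R N₁] [AddCommGroup N₂] [Module R N₂]
  [AddCommGroup N₃] [Module R N₃]

/-- the short complex in `ModuleCat` attached to an exact pair. -/
def sc (f : N₁ →ₗ[R] N₂) (g : N₂ →ₗ[R] N₃) (h : Function.Exact f g) :
    ShortComplex (ModuleCat.{0} R) :=
  ShortComplex.mk (ModuleCat.ofHom f) (ModuleCat.ofHom g) (by
    ext x; exact h.apply_apply_eq_zero x)

lemma sc_exact (f : N₁ →ₗ[R] N₂) (g : N₂ →ₗ[R] N₃) (h : Function.Exact f g)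
    (hf : Function.Injective f) (hg : Function.Surjective g) : (sc f g h).ShortExact where
  exact := by
    rw [ShortComplex.ShortExact.moduleCat_exact_iff_function_exact]
    exact h
  mono_f := (ModuleCat.mono_iff_injective _).2 hf
  epi_g := (ModuleCat.epi_iff_surjective _).2 hg

lemma res_res {J J' J'' : Ideal R} (h : J' ≤ J) (h' : J'' ≤ J') {Y : ModuleCat.{0} R} {i : ℕ}
    (x : Abelian.Ext (ModuleCat.of R (R ⧸ J)) Y i) :
    (Abelian.Ext.mk₀ (ModuleCat.ofHom (Submodule.factor h'))).comp
      ((Abelian.Ext.mk₀ (ModuleCat.ofHom (Submodule.factor h))).comp x (zero_add i)) (zero_add i) =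
    (Abelian.Ext.mk₀ (ModuleCat.ofHom (Submodule.factor (h'.trans h)))).comp x (zero_add i) := by
  rw [Abelian.Ext.mk₀_comp_mk₀_assoc]
  congr 2
  rw [← ModuleCat.ofHom_comp]
  congr 1
  ext
  rfl

lemma midc {a : Ideal R} {i : ℕ} {S' : ShortComplex (ModuleCat.{0} R)}
    (S : S'.ShortExact) (h1 : LCVc a i S'.X₁) (h3 : LCVc a i S'.X₃) :
    LCVc a i S'.X₂ := by
  intro J hJ x
  obtain ⟨J', hJ', ha', e⟩ := h3 J hJ (x.comp (Abelian.Ext.mk₀ S'.g) (add_zero _))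
  obtain ⟨y, hy⟩ := Abelian.Ext.covariant_sequence_exact₂ _ S
    ((Abelian.Ext.mk₀ (ModuleCat.ofHom (Submodule.factor hJ'))).comp x (zero_add i)) (by
      rw [Abelian.Ext.comp_assoc_of_third_deg_zero]; exact e)
  obtain ⟨J'', hJ'', ha'', e'⟩ := h1 J' ha' y
  refine ⟨J'', hJ''.trans hJ', ha'', ?_⟩
  rw [← res_res hJ' hJ'', ← hy, ← Abelian.Ext.comp_assoc_of_third_deg_zero]
  rw [e']
  simp

lemma mid {a : Ideal R} {i : ℕ} (f : N₁ →ₗ[R] N₂) (g : N₂ →ₗ[R] N₃) (h : Function.Exact f g)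
    (hf : Function.Injective f) (hg : Function.Surjective g) (h1 : LCV a i N₁) (h3 : LCV a i N₃) :
    LCV a i N₂ :=
  midc (sc_exact f g h hf hg) h1 h3

lemma rightc {a : Ideal R} {i : ℕ} {S' : ShortComplex (ModuleCat.{0} R)}
    (S : S'.ShortExact) (h2 : LCVc a i S'.X₂)
    (h1 : LCVc a (i + 1) S'.X₁) : LCVc a i S'.X₃ := by
  intro J hJ x
  obtain ⟨J', hJ', ha', e⟩ := h1 J hJ (x.comp S.extClass rfl)
  obtain ⟨y, hy⟩ := Abelian.Ext.covariant_sequence_exact₃ _ S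
    ((Abelian.Ext.mk₀ (ModuleCat.ofHom (Submodule.factor hJ'))).comp x (zero_add i)) rfl (by
      rw [Abelian.Ext.comp_assoc _ _ _ (zero_add i) rfl (by omega)]; exact e)
  obtain ⟨J'', hJ'', ha'', e'⟩ := h2 J' ha' y
  refine ⟨J'', hJ''.trans hJ', ha'', ?_⟩
  rw [← res_res hJ' hJ'', ← hy, ← Abelian.Ext.comp_assoc_of_third_deg_zero]
  rw [e']
  simp

lemma right {a : Ideal R} {i : ℕ} (f : N₁ →ₗ[R] N₂) (g : N₂ →ₗ[R] N₃) (h : Function.Exact f g)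
    (hf : Function.Injective f) (hg : Function.Surjective g) (h2 : LCV a i N₂)
    (h1 : LCV a (i + 1) N₁) : LCV a i N₃ :=
  rightc (sc_exact f g h hf hg) h2 h1

lemma leftc {a : Ideal R} {i : ℕ} {S' : ShortComplex (ModuleCat.{0} R)}
    (S : S'.ShortExact) (h3 : LCVc a i S'.X₃)
    (h2 : LCVc a (i + 1) S'.X₂) : LCVc a (i + 1) S'.X₁ := by
  intro J hJ x
  obtain ⟨J', hJ', ha', e⟩ := h2 J hJ (x.comp (Abelian.Ext.mk₀ S'.f) (add_zero _))
  obtain ⟨y, hy⟩ := Abelian.Ext.covariant_sequence_exact₁ _ S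
    ((Abelian.Ext.mk₀ (ModuleCat.ofHom (Submodule.factor hJ'))).comp x (zero_add (i + 1))) (by
      rw [Abelian.Ext.comp_assoc_of_third_deg_zero]; exact e) rfl
  obtain ⟨J'', hJ'', ha'', e'⟩ := h3 J' ha' y
  refine ⟨J'', hJ''.trans hJ', ha'', ?_⟩
  rw [← res_res hJ' hJ'', ← hy, ← Abelian.Ext.comp_assoc _ _ _ (zero_add i) rfl (by omega)]
  rw [e']
  simp

lemma left {a : Ideal R} {i : ℕ} (f : N₁ →ₗ[R] N₂) (g : N₂ →ₗ[R] N₃) (h : Function.Exact f g)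
    (hf : Function.Injective f) (hg : Function.Surjective g) (h3 : LCV a i N₃)
    (h2 : LCV a (i + 1) N₂) : LCV a (i + 1) N₁ :=
  leftc (sc_exact f g h hf hg) h3 h2

lemma of_injective {a : Ideal R} {i : ℕ} [Module.Injective R N₁] : LCV a (i + 1) N₁ := by
  intro J hJ x
  have : Injective (ModuleCat.of R N₁) := Module.injective_object_of_injective_module R N₁
  exact ⟨J, le_rfl, hJ, by rw [Abelian.Ext.eq_zero_of_injective x]; simp⟩

lemma of_subsingleton {a : Ideal R} {i : ℕ} [Subsingleton N₁] : LCV a i N₁ := by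
  intro J hJ x
  have : Limits.IsZero (ModuleCat.of R N₁) := ModuleCat.isZero_of_subsingleton _
  refine ⟨J, le_rfl, hJ, ?_⟩
  rw [← Abelian.Ext.comp_mk₀_id x, this.eq_of_src (𝟙 _) 0]; simp

lemma of_equiv {a : Ideal R} {i : ℕ} (e : N₁ ≃ₗ[R] N₂) (h : LCV a i N₁) : LCV a i N₂ :=
  mid (N₃ := PUnit) e.toLinearMap 0 (by
    intro x; simp) e.injective (fun x => ⟨0, rfl⟩) h of_subsingleton

/-- `LCV` only depends on the radical. -/
lemma of_radical {a b : Ideal R} {i : ℕ} (hab : a.radical = b.radical) (h : LCV a i N₁) :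
    LCV b i N₁ := by
  have key : ∀ J : Ideal R, b ≤ J.radical ↔ a ≤ J.radical := by
    intro J
    rw [← Ideal.radical_le_radical_iff, ← hab, Ideal.radical_le_radical_iff]
  intro J hJ x
  obtain ⟨J', hJ', ha', e⟩ := h J ((key J).1 hJ) x
  exact ⟨J', hJ', (key J').2 ha', e⟩

lemma top {i : ℕ} : LCV (⊤ : Ideal R) i N₁ := by
  intro J hJ x
  refine ⟨J, le_rfl, hJ, ?_⟩
  have hJ : J = ⊤ := by rwa [top_le_iff, Ideal.radical_eq_top] at hJ
  subst hJ
  have : Limits.IsZero (ModuleCat.of R (R ⧸ (⊤ : Ideal R))) := ModuleCat.isZero_of_subsingleton _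
  rw [← Abelian.Ext.mk₀_id_comp x, this.eq_of_src (𝟙 _) 0]; simp

/-- dimension shifting -/
lemma shift {a : Ideal R} {i : ℕ} (f : N₁ →ₗ[R] N₂) (g : N₂ →ₗ[R] N₃) (h : Function.Exact f g)
    (hf : Function.Injective f) (hg : Function.Surjective g) [Module.Injective R N₂] :
    LCV a (i + 2) N₁ ↔ LCV a (i + 1) N₃ :=
  ⟨fun H => right f g h hf hg of_injective H, fun H => left f g h hf hg H of_injective⟩

/-- torsion elements -/
def Tor (a : Ideal R) (z : N₁) : Prop := ∃ J : Ideal R, a ≤ J.radical ∧ ∀ r ∈ J, r • z = 0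

lemma onec {a : Ideal R} {S' : ShortComplex (ModuleCat.{0} R)} (S : S'.ShortExact)
    [Injective S'.X₂] : LCVc a 1 S'.X₁ ↔
      ∀ z : S'.X₃, Tor a z → ∃ e : S'.X₂, Tor a e ∧ S'.g.hom e = z := by
  constructor
  · rintro H z ⟨J, hJ, hz⟩
    let φ : (R ⧸ J) →ₗ[R] S'.X₃ := Submodule.liftQ J (LinearMap.toSpanSingleton R S'.X₃ z)
      (fun r hr => by simpa using hz r hr)
    obtain ⟨J', hJ', ha', e⟩ := H J hJ ((Abelian.Ext.mk₀ (show ModuleCat.of R (R ⧸ J) ⟶ S'.X₃ from ModuleCat.ofHom φ)).comp S.extClass rfl)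
    rw [Abelian.Ext.mk₀_comp_mk₀_assoc] at e
    obtain ⟨y, hy⟩ := Abelian.Ext.covariant_sequence_exact₃ _ S _ rfl e
    obtain ⟨ψ, rfl⟩ := Abelian.Ext.addEquiv₀.symm.surjective y
    simp only [Abelian.Ext.addEquiv₀_symm_apply] at hy
    rw [Abelian.Ext.mk₀_comp_mk₀] at hy
    have hy := Abelian.Ext.addEquiv₀.symm.injective hy
    refine ⟨ψ.hom (Submodule.Quotient.mk 1), ⟨J', ha', ?_⟩, ?_⟩
    · intro r hr
      rw [← map_smul, ← Submodule.Quotient.mk_smul, smul_eq_mul, mul_one,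
        (Submodule.Quotient.mk_eq_zero J').2 hr, map_zero]
    · have := congrArg (fun q => q.hom (Submodule.Quotient.mk 1)) hy
      have h1 : φ (Submodule.Quotient.mk 1) = z := by
        simp only [φ]; rw [Submodule.liftQ_apply]; simp
      rw [← h1]
      exact this
  · intro H J hJ x
    obtain ⟨y, hy⟩ := Abelian.Ext.covariant_sequence_exact₁ _ S x (Abelian.Ext.eq_zero_of_injective _) rfl
    obtain ⟨ψ, rfl⟩ := Abelian.Ext.addEquiv₀.symm.surjective y
    obtain ⟨e, ⟨J₁, hJ₁, he⟩, hge⟩ := H (ψ.hom (Submodule.Quotient.mk 1)) ⟨J, hJ, fun r hr => by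
      rw [← map_smul, ← Submodule.Quotient.mk_smul, smul_eq_mul, mul_one,
        (Submodule.Quotient.mk_eq_zero J).2 hr, map_zero]⟩
    refine ⟨J ⊓ J₁, inf_le_left, ?_, ?_⟩
    · rw [Ideal.radical_inf]; exact le_inf hJ hJ₁
    · rw [← hy, Abelian.Ext.addEquiv₀_symm_apply, Abelian.Ext.mk₀_comp_mk₀_assoc]
      let φ : (R ⧸ (J ⊓ J₁)) →ₗ[R] S'.X₂ := Submodule.liftQ _ (LinearMap.toSpanSingleton R S'.X₂ e)
        (fun r hr => by simpa using he r hr.2)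
      have : ModuleCat.ofHom (Submodule.factor (inf_le_left : J ⊓ J₁ ≤ J)) ≫ ψ =
        (show ModuleCat.of R (R ⧸ (J ⊓ J₁)) ⟶ S'.X₂ from ModuleCat.ofHom φ) ≫ S'.g := by
        ext
        have h1 : φ (Submodule.Quotient.mk 1) = e := by
          simp only [φ]; rw [Submodule.liftQ_apply]; simp
        change ψ.hom (Submodule.Quotient.mk 1) = S'.g.hom (φ (Submodule.Quotient.mk 1))
        rw [h1, hge]
      rw [this, ← Abelian.Ext.mk₀_comp_mk₀_assoc, S.comp_extClass, Abelian.Ext.comp_zero]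

lemma one {a : Ideal R} (f : N₁ →ₗ[R] N₂) (g : N₂ →ₗ[R] N₃) (h : Function.Exact f g)
    (hf : Function.Injective f) (hg : Function.Surjective g) [Module.Injective R N₂] :
    LCV a 1 N₁ ↔ ∀ z : N₃, Tor a z → ∃ e : N₂, Tor a e ∧ g e = z := by
  have : Injective (sc f g h).X₂ := Module.injective_object_of_injective_module R N₂
  exact onec (sc_exact f g h hf hg)

end LCV

namespace LCV

section Complexes

variable {R : Type} [CommRing R]

/-- `x` is the homology class of the cocycle `z`. -/
def IsClass (K : CochainComplex (ModuleCat.{0} R) ℕ) (n : ℕ) (x : K.homology n) (z : K.X n) :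
    Prop := ∃ c : K.cycles n, K.homologyπ n c = x ∧ K.iCycles n c = z

lemma exists_class (K : CochainComplex (ModuleCat.{0} R) ℕ) (n : ℕ) (x : K.homology n) :
    ∃ z : K.X n, K.d n (n + 1) z = 0 ∧ IsClass K n x z := by
  obtain ⟨c, hc⟩ := (ModuleCat.epi_iff_surjective (K.homologyπ n)).1 inferInstance x
  refine ⟨K.iCycles n c, ?_, c, hc, rfl⟩
  have := K.iCycles_d n (n + 1)
  exact congrArg (fun q => q.hom c) this

lemma exists_of_cocycle (K : CochainComplex (ModuleCat.{0} R) ℕ) (n : ℕ) (z : K.X n)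
    (hz : K.d n (n + 1) z = 0) : ∃ x : K.homology n, IsClass K n x z := by
  let f : ModuleCat.of R R ⟶ K.X n := ModuleCat.ofHom (LinearMap.toSpanSingleton R _ z)
  have hf : f ≫ K.d n (n + 1) = 0 := by
    ext
    simpa [f] using hz
  refine ⟨_, K.liftCycles f (n + 1) (by simp) hf (1 : R), rfl, ?_⟩
  have := congrArg (fun q => q.hom (1 : R)) (K.liftCycles_i f (n + 1) (by simp) hf)
  exact this.trans (by simp [f])

lemma IsClass.eq_zero_iff {K : CochainComplex (ModuleCat.{0} R) ℕ} {n : ℕ} {x : K.homology (n + 1)}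
    {z : K.X (n + 1)} (h : IsClass K (n + 1) x z) : x = 0 ↔ ∃ w : K.X n, K.d n (n + 1) w = z := by
  obtain ⟨c, rfl, rfl⟩ := h
  have hinj : Function.Injective (K.iCycles (n + 1)) :=
    (ModuleCat.mono_iff_injective (K.iCycles (n + 1))).1 inferInstance
  have hex : (ShortComplex.mk (K.toCycles n (n + 1)) (K.homologyπ (n + 1)) (by simp)).Exact :=
    ShortComplex.exact_of_g_is_cokernel _ (K.homologyIsCokernel n (n + 1) (by simp))
  rw [ShortComplex.ShortExact.moduleCat_exact_iff_function_exact] at hex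
  have hti : ∀ w, K.iCycles (n + 1) (K.toCycles n (n + 1) w) = K.d n (n + 1) w := fun w =>
    congrArg (fun q => q.hom w) (K.toCycles_i n (n + 1))
  constructor
  · intro h0
    obtain ⟨w, hw⟩ := (hex c).1 h0
    exact ⟨w, by rw [← hti]; exact congrArg _ hw⟩
  · rintro ⟨w, hw⟩
    refine (hex c).2 ⟨w, hinj ?_⟩
    rw [← hw]
    exact hti w

lemma IsClass.map {K K' : CochainComplex (ModuleCat.{0} R) ℕ} {n : ℕ} {x : K.homology n}
    {z : K.X n} (h : IsClass K n x z) (κ : K ⟶ K') :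
    IsClass K' n (HomologicalComplex.homologyMap κ n x) (κ.f n z) := by
  obtain ⟨c, rfl, rfl⟩ := h
  refine ⟨HomologicalComplex.cyclesMap κ n c, ?_, ?_⟩
  · exact (congrArg (fun q => q.hom c) (HomologicalComplex.homologyπ_naturality κ n)).symm
  · exact congrArg (fun q => q.hom c) (HomologicalComplex.cyclesMap_i κ n)

end Complexes

section OldExt

variable {R : Type} [CommRing R] {X X' : ModuleCat.{0} R} (P : ProjectiveResolution X)
  (P' : ProjectiveResolution X') (φ : P'.complex ⟶ P.complex) (Y : ModuleCat.{0} R)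

/-- precomposition. -/
noncomputable def pre : P.complex.linearYonedaObj R Y ⟶ P'.complex.linearYonedaObj R Y :=
  (HomologicalComplex.unopFunctor _ _).map
    ((((linearYoneda R (ModuleCat.{0} R)).obj Y).rightOp.mapHomologicalComplex _).map φ).op

lemma glue {C : Type*} [Category C] {A A' B B' E E' : C} (D : A ⟶ A') (i : A ⟶ B) (i' : A' ⟶ B')
    (m : B ⟶ B') (H : E ≅ B) (H' : E' ≅ B') (hm : E ⟶ E') (h1 : D ≫ i' = i ≫ m)
    (h2 : H.hom ≫ m = hm ≫ H'.hom) : D ≫ i' ≫ H'.inv = (i ≫ H.inv) ≫ hm := by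
  rw [← Category.assoc, h1, Category.assoc, Category.assoc]
  congr 1
  rw [Iso.eq_inv_comp, ← Category.assoc, Iso.comp_inv_eq, h2]

lemma isoExt_naturality (g : X' ⟶ X) (comm : φ.f 0 ≫ P.π.f 0 = P'.π.f 0 ≫ g) (n : ℕ) :
    ((Ext R (ModuleCat.{0} R) n).map g.op).app Y ≫ (P'.isoExt n Y).hom =
      (P.isoExt n Y).hom ≫ HomologicalComplex.homologyMap (pre P P' φ Y) n := by
  have h := ProjectiveResolution.isoLeftDerivedObj_inv_naturality g P' P φ comm
    ((linearYoneda R (ModuleCat.{0} R)).obj Y).rightOp n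
  have h1 := congrArg Quiver.Hom.unop h
  have h2 := congrArg Quiver.Hom.unop (HomologicalComplex.homologyOp_hom_naturality
    (pre P P' φ Y) n)
  exact glue _ _ _ _ (HomologicalComplex.homologyOp (P.complex.linearYonedaObj R Y) n).unop
    (HomologicalComplex.homologyOp (P'.complex.linearYonedaObj R Y) n).unop _ h1 h2

/-- comparison relation between the two flavours of Ext -/
def Rel (n : ℕ) (x : ((Ext R (ModuleCat.{0} R) (n + 1)).obj (Opposite.op X)).obj Y)
    (ξ : Abelian.Ext X Y (n + 1)) : Prop :=
  ∃ (z : P.complex.X (n + 1) ⟶ Y) (hz : P.complex.d (n + 2) (n + 1) ≫ z = 0),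
    IsClass (P.complex.linearYonedaObj R Y) (n + 1) ((P.isoExt (n + 1) Y).hom x) z ∧
      ξ = P.extMk z (n + 2) rfl hz

variable {Y}

lemma exists_rel {n : ℕ} (x : ((Ext R (ModuleCat.{0} R) (n + 1)).obj (Opposite.op X)).obj Y) :
    ∃ ξ, Rel P Y n x ξ := by
  obtain ⟨z, hz, h⟩ := exists_class (P.complex.linearYonedaObj R Y) (n + 1)
    ((P.isoExt (n + 1) Y).hom x)
  exact ⟨_, z, hz, h, rfl⟩

lemma exists_rel' {n : ℕ} (ξ : Abelian.Ext X Y (n + 1)) :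
    ∃ x, Rel P Y n x ξ := by
  obtain ⟨z, hz, rfl⟩ := P.extMk_surjective ξ (n + 2) rfl
  obtain ⟨x, hx⟩ := exists_of_cocycle (P.complex.linearYonedaObj R Y) (n + 1) z hz
  refine ⟨(P.isoExt (n + 1) Y).inv x, z, hz, ?_, rfl⟩
  have : (P.isoExt (n + 1) Y).hom ((P.isoExt (n + 1) Y).inv x) = x :=
    congrArg (fun q => q.hom x) (P.isoExt (n + 1) Y).inv_hom_id
  rw [this]; exact hx

variable {P P'}

lemma Rel.eq_zero_iff {n : ℕ} {x : ((Ext R (ModuleCat.{0} R) (n + 1)).obj (Opposite.op X)).obj Y}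
    {ξ : Abelian.Ext X Y (n + 1)} (h : Rel P Y n x ξ) : x = 0 ↔ ξ = 0 := by
  obtain ⟨z, hz, h, rfl⟩ := h
  rw [P.extMk_eq_zero_iff _ _ _ _ n rfl]
  have h0 : x = 0 ↔ (P.isoExt (n + 1) Y).hom x = 0 := by
    constructor
    · rintro rfl; exact map_zero (P.isoExt (n + 1) Y).hom.hom
    · intro h
      have : (P.isoExt (n + 1) Y).inv ((P.isoExt (n + 1) Y).hom x) = x :=
        congrArg (fun q => q.hom x) (P.isoExt (n + 1) Y).hom_inv_id
      rw [← this, h]; exact map_zero (P.isoExt (n + 1) Y).inv.hom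
  rw [h0, h.eq_zero_iff]
  exact Iff.rfl

lemma Rel.map {n : ℕ} {x : ((Ext R (ModuleCat.{0} R) (n + 1)).obj (Opposite.op X)).obj Y}
    {ξ : Abelian.Ext X Y (n + 1)} (h : Rel P Y n x ξ) (P' : ProjectiveResolution X') (g : X' ⟶ X) :
    Rel P' Y n (((Ext R (ModuleCat.{0} R) (n + 1)).map g.op).app Y x)
      ((Abelian.Ext.mk₀ g).comp ξ (zero_add _)) := by
  obtain ⟨z, hz, h, rfl⟩ := h
  let φ : ProjectiveResolution.Hom P' P g :=
    ⟨ProjectiveResolution.lift g P' P, by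
      rw [ProjectiveResolution.lift_commutes_zero]; simp⟩
  rw [ProjectiveResolution.mk₀_comp_extMk (φ := φ)]
  refine ⟨φ.hom.f (n + 1) ≫ z, by simp [← φ.hom.comm_assoc, hz], ?_, rfl⟩
  have h1 := h.map (pre P P' φ.hom Y)
  have h2 := congrArg (fun q => q.hom x) (isoExt_naturality P P' φ.hom Y g
    (ProjectiveResolution.lift_commutes_zero _ _ _) (n + 1))
  exact h2 ▸ h1

end OldExt

end LCV

namespace LCV

open Limits localCohomology in
lemma subsingleton_iff_aux {R : Type} [CommRing R] (a : Ideal R) (i : ℕ) (M : ModuleCat.{0} R) :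
    Subsingleton ((localCohomology a i).obj M) ↔
      ∀ (t : ℕ) (x : ((Ext R (ModuleCat.{0} R) i).obj (Opposite.op (ModuleCat.of R (R ⧸ a ^ t)))).obj M),
        ∃ (m : ℕ) (h : t ≤ m), ((Ext R (ModuleCat.{0} R) i).map
          (ModuleCat.ofHom (Submodule.factor (Ideal.pow_le_pow_right h : a ^ m ≤ a ^ t))).op).app M x = 0 := by
  let D := localCohomology.diagram (localCohomology.idealPowersDiagram a) i
  have hD : HasColimit D := localCohomology.hasColimitDiagram.{0, 0} _ _
  have e : localCohomology a i = colimit D := rfl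
  let c := ((evaluation (ModuleCat.{0} R) (ModuleCat.{0} R)).obj M).mapCocone (colimit.cocone D)
  have hc : IsColimit c := isColimitOfPreserves _ (colimit.isColimit D)
  have e' : (localCohomology a i).obj M = c.pt := rfl
  rw [e']
  constructor
  · intro hs t x
    have := (Concrete.isColimit_rep_eq_iff_exists _ hc (i := Opposite.op (Opposite.op t))
      (j := Opposite.op (Opposite.op t)) x (0 : _)).1 (hs.elim _ _)
    obtain ⟨⟨⟨m⟩⟩, f, g, hfg⟩ := this
    refine ⟨m, f.unop.unop.down.down, ?_⟩
    refine Eq.trans ?_ (hfg.trans (map_zero _))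
    rfl
  · intro H
    refine subsingleton_of_forall_eq 0 fun y => ?_
    obtain ⟨⟨⟨t⟩⟩, x, rfl⟩ := Concrete.isColimit_exists_rep _ hc y
    obtain ⟨m, h, hm⟩ := H t x
    have := (Concrete.isColimit_rep_eq_iff_exists _ hc (i := Opposite.op (Opposite.op t))
      (j := Opposite.op (Opposite.op t)) x (0 : _)).2
      ⟨Opposite.op (Opposite.op m), (homOfLE h).op.op, (homOfLE h).op.op, ?_⟩
    · exact this.trans (map_zero _)
    · refine Eq.trans ?_ (hm.trans (map_zero _).symm)
      rfl

theorem subsingleton_iff {R : Type} [CommRing R] [IsNoetherianRing R] (a : Ideal R) (i : ℕ)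
    (M : ModuleCat.{0} R) :
    Subsingleton ((localCohomology a (i + 1)).obj M) ↔ LCVc a (i + 1) M := by
  rw [subsingleton_iff_aux]
  constructor
  · intro H J hJ ξ
    obtain ⟨t, ht⟩ := Ideal.exists_pow_le_of_le_radical_of_fg hJ (IsNoetherian.noetherian a)
    let P := projectiveResolution (ModuleCat.of R (R ⧸ a ^ t))
    obtain ⟨x, hx⟩ := exists_rel' P
      ((Abelian.Ext.mk₀ (ModuleCat.ofHom (Submodule.factor ht))).comp ξ (zero_add _))
    obtain ⟨m, h, hm⟩ := H t x
    refine ⟨a ^ m, (Ideal.pow_le_pow_right h).trans ht, fun r hr => ⟨m, Ideal.pow_mem_pow hr m⟩, ?_⟩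
    rw [← res_res ht (Ideal.pow_le_pow_right h)]
    exact (hx.map (projectiveResolution _) _).eq_zero_iff.1 hm
  · intro H t x
    let P := projectiveResolution (ModuleCat.of R (R ⧸ a ^ t))
    obtain ⟨ξ, hξ⟩ := exists_rel P x
    obtain ⟨J', h, hJ', e⟩ := H (a ^ t) (fun r hr => ⟨t, Ideal.pow_mem_pow hr t⟩) ξ
    obtain ⟨m, hm⟩ := Ideal.exists_pow_le_of_le_radical_of_fg hJ' (IsNoetherian.noetherian a)
    have hm' : a ^ (t + m) ≤ J' := (Ideal.pow_le_pow_right (by omega)).trans hm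
    refine ⟨t + m, by omega, ?_⟩
    refine (hξ.map (projectiveResolution _) _).eq_zero_iff.2 ?_
    rw [← res_res h hm', e]
    simp

end LCV

namespace LCV

section Torsion

variable {R : Type} [CommRing R]

lemma Tor.smul {N : Type} [AddCommGroup N] [Module R N] {a : Ideal R} {z : N} (h : Tor a z) (r : R) :
    Tor a (r • z) := by
  obtain ⟨J, h1, h2⟩ := h
  exact ⟨J, h1, fun s hs => by rw [smul_comm, h2 s hs, smul_zero]⟩

lemma Tor.map {N N' : Type} [AddCommGroup N] [Module R N] [AddCommGroup N'] [Module R N']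
    {a : Ideal R} {z : N} (h : Tor a z) (f : N →ₗ[R] N') : Tor a (f z) := by
  obtain ⟨J, h1, h2⟩ := h
  exact ⟨J, h1, fun s hs => by rw [← map_smul, h2 s hs, map_zero]⟩

lemma Tor.of_map {N N' : Type} [AddCommGroup N] [Module R N] [AddCommGroup N'] [Module R N']
    {a : Ideal R} {z : N} (f : N →ₗ[R] N') (hf : Function.Injective f) (h : Tor a (f z)) :
    Tor a z := by
  obtain ⟨J, h1, h2⟩ := h
  exact ⟨J, h1, fun s hs => hf (by rw [map_smul, h2 s hs, map_zero])⟩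

lemma Tor.add {N : Type} [AddCommGroup N] [Module R N] {a : Ideal R} {z w : N} (h : Tor a z)
    (h' : Tor a w) : Tor a (z + w) := by
  obtain ⟨J, h1, h2⟩ := h
  obtain ⟨J', h1', h2'⟩ := h'
  refine ⟨J ⊓ J', by rw [Ideal.radical_inf]; exact le_inf h1 h1', fun s hs => ?_⟩
  rw [smul_add, h2 s hs.1, h2' s hs.2, add_zero]

lemma Tor.mono {N : Type} [AddCommGroup N] [Module R N] {a b : Ideal R} (hab : a ≤ b) {z : N}
    (h : Tor b z) : Tor a z := by
  obtain ⟨J, h1, h2⟩ := h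
  exact ⟨J, hab.trans h1, h2⟩

lemma Tor.sup {N : Type} [AddCommGroup N] [Module R N] {a b : Ideal R} {z : N}
    (h : Tor a z) (h' : Tor b z) : Tor (a ⊔ b) z := by
  obtain ⟨J, h1, h2⟩ := h
  obtain ⟨J', h1', h2'⟩ := h'
  refine ⟨J ⊔ J', sup_le (h1.trans (Ideal.radical_mono le_sup_left))
    (h1'.trans (Ideal.radical_mono le_sup_right)), fun s hs => ?_⟩
  obtain ⟨p, hp, q, hq, rfl⟩ := Submodule.mem_sup.1 hs
  rw [add_smul, h2 p hp, h2' q hq, add_zero]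

lemma Tor.zero {N : Type} [AddCommGroup N] [Module R N] (a : Ideal R) : Tor a (0 : N) :=
  ⟨⊤, by simp [Ideal.radical_top], fun r _ => smul_zero r⟩

lemma Tor.bot {N : Type} [AddCommGroup N] [Module R N] (z : N) : Tor (⊥ : Ideal R) z :=
  ⟨⊥, bot_le, by simp⟩

/-- the torsion submodule -/
def Gam (a : Ideal R) (N : Type) [AddCommGroup N] [Module R N] : Submodule R N where
  carrier := {z | Tor a z}
  add_mem' := Tor.add
  zero_mem' := Tor.zero a
  smul_mem' r _ h := h.smul r

lemma mem_Gam {a : Ideal R} {N : Type} [AddCommGroup N] [Module R N] {z : N} :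
    z ∈ Gam a N ↔ Tor a z := Iff.rfl

lemma Tor.exists_pow [IsNoetherianRing R] {N : Type} [AddCommGroup N] [Module R N] {a : Ideal R}
    {z : N} (h : Tor a z) : ∃ n : ℕ, ∀ r ∈ a ^ n, r • z = 0 := by
  obtain ⟨J, h1, h2⟩ := h
  obtain ⟨n, hn⟩ := Ideal.exists_pow_le_of_le_radical_of_fg h1 (IsNoetherian.noetherian a)
  exact ⟨n, fun r hr => h2 r (hn hr)⟩

lemma Tor.of_pow {N : Type} [AddCommGroup N] [Module R N] {a : Ideal R} {z : N} (n : ℕ)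
    (h : ∀ r ∈ a ^ n, r • z = 0) : Tor a z :=
  ⟨a ^ n, fun _ hr => ⟨n, Ideal.pow_mem_pow hr n⟩, h⟩

/-- extension lemma with annihilators -/
lemma ext_kill {E : Type} [AddCommGroup E] [Module R E] [Module.Injective R E] (I J : Ideal R)
    (g : I →ₗ[R] E) (hg : ∀ (r : R) (h : r ∈ I), r ∈ J → g ⟨r, h⟩ = 0) :
    ∃ e : E, (∀ r ∈ J, r • e = 0) ∧ ∀ (r : R) (h : r ∈ I), r • e = g ⟨r, h⟩ := by
  let p : R →ₗ.[R] E := ⟨I, g⟩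
  let q : R →ₗ.[R] E := ⟨J, 0⟩
  have hpq : ∀ (x : p.domain) (y : q.domain), (x : R) = y → p x = q y := by
    intro x y hxy
    have := hg x x.2 (by rw [hxy]; exact y.2)
    exact this
  obtain ⟨φ, hφ⟩ := Module.Injective.out (p.sup q hpq).domain.subtype
    (Submodule.subtype_injective _) (p.sup q hpq).toFun
  have key : ∀ r : R, r • φ 1 = φ r := fun r => by rw [← map_smul, smul_eq_mul, mul_one]
  refine ⟨φ 1, fun r hr => ?_, fun r hr => ?_⟩
  · rw [key]
    have h := (LinearPMap.right_le_sup p q hpq).2 (x := ⟨r, hr⟩)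
      (y := ⟨r, Submodule.mem_sup_right hr⟩) rfl
    exact (hφ ⟨r, Submodule.mem_sup_right hr⟩).trans h.symm
  · rw [key]
    have h := (LinearPMap.left_le_sup p q hpq).2 (x := ⟨r, hr⟩)
      (y := ⟨r, Submodule.mem_sup_left hr⟩) rfl
    exact (hφ ⟨r, Submodule.mem_sup_left hr⟩).trans h.symm

lemma artin_rees [IsNoetherianRing R] (a I : Ideal R) (n : ℕ) :
    ∃ m, a ^ m ⊓ I ≤ a ^ n • I := by
  obtain ⟨k, hk⟩ := Ideal.exists_pow_inf_eq_pow_smul a (I : Submodule R R)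
  refine ⟨n + k, ?_⟩
  have := hk (n + k) (by omega)
  simp only [smul_eq_mul, Ideal.mul_top, Nat.add_sub_cancel] at this ⊢
  rw [this]
  exact Ideal.mul_mono_right inf_le_right

lemma exists_pow_fg [IsNoetherianRing R] {N : Type} [AddCommGroup N] [Module R N] (a : Ideal R)
    (L : Submodule R N) (hL : L.FG) (h : ∀ z ∈ L, Tor a z) :
    ∃ n : ℕ, ∀ r ∈ a ^ n, ∀ z ∈ L, r • z = 0 := by
  obtain ⟨s, rfl⟩ := hL
  choose! n hn using fun z (hz : z ∈ s) => (h z (Submodule.subset_span hz)).exists_pow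
  refine ⟨s.sup n, fun r hr z hz => ?_⟩
  induction hz using Submodule.span_induction with
  | mem x hx => exact hn x hx r (Ideal.pow_le_pow_right (Finset.le_sup hx) hr)
  | zero => simp
  | add x y _ _ hx hy => rw [smul_add, hx, hy, add_zero]
  | smul t x _ hx => rw [smul_comm, hx, smul_zero]

instance Gam_injective [IsNoetherianRing R] {E : Type} [AddCommGroup E] [Module R E]
    [Module.Injective R E] (a : Ideal R) : Module.Injective R (Gam a E) := by
  apply Module.Baer.injective
  intro I g
  obtain ⟨n, hn⟩ := exists_pow_fg a (LinearMap.range ((Gam a E).subtype ∘ₗ g))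
    (IsNoetherian.noetherian (⊤ : Submodule R I) |>.map _ |> fun h => by rwa [LinearMap.range_eq_map])
    (by rintro _ ⟨x, rfl⟩; exact (g x).2)
  obtain ⟨m, hm⟩ := artin_rees a I n
  have hz : ∀ (r : R) (h : r ∈ I), r ∈ a ^ n • I → (g ⟨r, h⟩ : E) = 0 := by
    intro r h hr
    suffices H : ∃ h' : r ∈ I, (g ⟨r, h'⟩ : E) = 0 from H.2
    clear h
    induction hr using Submodule.smul_induction_on' with
    | smul s hs x hx =>
      refine ⟨I.mul_mem_left s hx, ?_⟩
      have := hn s hs _ ⟨⟨x, hx⟩, rfl⟩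
      rw [← map_smul] at this
      exact this
    | add x _ y _ hx hy =>
      obtain ⟨hx, hx'⟩ := hx
      obtain ⟨hy, hy'⟩ := hy
      refine ⟨I.add_mem hx hy, ?_⟩
      have : g ⟨x + y, I.add_mem hx hy⟩ = g ⟨x, hx⟩ + g ⟨y, hy⟩ := by
        rw [← map_add]; rfl
      rw [this, Submodule.coe_add, hx', hy', add_zero]
  obtain ⟨e, he, he'⟩ := ext_kill I (a ^ m) ((Gam a E).subtype ∘ₗ g)
    (fun r h hr => hz r h (hm ⟨hr, h⟩))
  refine ⟨LinearMap.toSpanSingleton R _ ⟨e, Tor.of_pow m he⟩, fun r hr => ?_⟩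
  apply Subtype.ext
  exact he' r hr

lemma exists_inj (N : Type) [AddCommGroup N] [Module R N] :
    ∃ (E : Type) (_ : AddCommGroup E) (_ : Module R E) (f : N →ₗ[R] E),
      Module.Injective R E ∧ Function.Injective f := by
  let X := ModuleCat.of R N
  refine ⟨(Injective.under X : ModuleCat.{0} R), inferInstance, inferInstance, (Injective.ι X).hom, ?_, ?_⟩
  · have : Injective (ModuleCat.of R (Injective.under X : ModuleCat.{0} R)) :=
      inferInstanceAs (Injective (Injective.under X))
    exact Module.injective_module_of_injective_object R _
  · exact (ModuleCat.mono_iff_injective (Injective.ι X)).1 inferInstance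

lemma exists_seq [IsNoetherianRing R] {N : Type} [AddCommGroup N] [Module R N] (c : Ideal R)
    (hN : ∀ z : N, Tor c z) :
    ∃ (E : Type) (_ : AddCommGroup E) (_ : Module R E) (C : Type) (_ : AddCommGroup C)
      (_ : Module R C) (f : N →ₗ[R] E) (g : E →ₗ[R] C),
      Module.Injective R E ∧ Function.Injective f ∧ Function.Surjective g ∧ Function.Exact f g ∧
      (∀ z : E, Tor c z) ∧ ∀ z : C, Tor c z := by
  obtain ⟨E, _, _, f, _, hf⟩ := exists_inj (R := R) N
  have hE : ∀ z : Gam c E, Tor c z := fun z =>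
    Tor.of_map (Gam c E).subtype (Submodule.subtype_injective _) z.2
  let f' : N →ₗ[R] Gam c E := f.codRestrict _ (fun x => (hN x).map f)
  refine ⟨Gam c E, inferInstance, inferInstance, Gam c E ⧸ LinearMap.range f', inferInstance,
    inferInstance, f', Submodule.mkQ _, inferInstance, ?_, Submodule.mkQ_surjective _, ?_, hE, ?_⟩
  · intro x y h
    exact hf (congrArg Subtype.val h)
  · exact LinearMap.exact_map_mkQ_range f'
  · intro z
    obtain ⟨w, rfl⟩ := Submodule.mkQ_surjective _ z
    exact (hE w).map _

lemma exists_seq' [IsNoetherianRing R] (N : Type) [AddCommGroup N] [Module R N] :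
    ∃ (E : Type) (_ : AddCommGroup E) (_ : Module R E) (C : Type) (_ : AddCommGroup C)
      (_ : Module R C) (f : N →ₗ[R] E) (g : E →ₗ[R] C),
      Module.Injective R E ∧ Function.Injective f ∧ Function.Surjective g ∧ Function.Exact f g := by
  obtain ⟨E, i1, i2, C, i3, i4, f, g, h1, h2, h3, h4, -⟩ := exists_seq (R := R) (N := N) ⊥ Tor.bot
  exact ⟨E, i1, i2, C, i3, i4, f, g, h1, h2, h3, h4⟩

end Torsion

end LCV

namespace LCV

section Bounds

variable {R : Type} [CommRing R] [IsNoetherianRing R]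

/-- restriction to torsion -/
def gmap (b : Ideal R) {N E : Type} [AddCommGroup N] [Module R N] [AddCommGroup E] [Module R E]
    (f : N →ₗ[R] E) : Gam b N →ₗ[R] Gam b E := f.restrict (fun _ hx => Tor.map hx f)

lemma gmap_coe (b : Ideal R) {N E : Type} [AddCommGroup N] [Module R N] [AddCommGroup E]
    [Module R E] (f : N →ₗ[R] E) (x : Gam b N) : (gmap b f x : E) = f x := rfl

lemma gmap_props (b : Ideal R) {N E C : Type} [AddCommGroup N] [Module R N] [AddCommGroup E]
    [Module R E] [AddCommGroup C] [Module R C] (f : N →ₗ[R] E) (g : E →ₗ[R] C)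
    (h : Function.Exact f g) (hf : Function.Injective f) (hg : Function.Surjective g)
    [Module.Injective R E] (h1 : LCV b 1 N) :
    Function.Injective (gmap b f) ∧ Function.Surjective (gmap b g) ∧
      Function.Exact (gmap b f) (gmap b g) := by
  refine ⟨fun x y hxy => Subtype.ext (hf (congrArg Subtype.val hxy)), fun z => ?_, fun y => ?_⟩
  · obtain ⟨e, he, hez⟩ := (one f g h hf hg).1 h1 z z.2
    exact ⟨⟨e, he⟩, Subtype.ext hez⟩
  · constructor
    · intro hy
      obtain ⟨x, hx⟩ := (h y).1 (congrArg Subtype.val hy)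
      exact ⟨⟨x, Tor.of_map f hf (by rw [hx]; exact y.2)⟩, Subtype.ext hx⟩
    · rintro ⟨x, rfl⟩
      exact Subtype.ext (h.apply_apply_eq_zero x)

lemma sum_zero (a b : Ideal R) (i : ℕ) : ∀ (N : Type) [AddCommGroup N] [Module R N]
    (_ : ∀ j, LCV b (j + 1) N) (_ : LCV a (i + 1) (Gam b N)), LCV (a ⊔ b) (i + 1) N := by
  induction i with
  | zero =>
    intro N _ _ hb ha
    obtain ⟨E, _, _, C, _, _, f, g, _, hf, hg, hfg⟩ := exists_seq' (R := R) N
    obtain ⟨h1, h2, h3⟩ := gmap_props b f g hfg hf hg (hb 0)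
    rw [zero_add, one f g hfg hf hg]
    rw [zero_add, one _ _ h3 h1 h2] at ha
    intro z hz
    obtain ⟨e, he, hez⟩ := ha ⟨z, hz.mono le_sup_right⟩
      (Tor.of_map (Gam b C).subtype (Submodule.subtype_injective _) (hz.mono le_sup_left))
    exact ⟨e, (he.map (Gam b E).subtype).sup e.2, congrArg Subtype.val hez⟩
  | succ i ih =>
    intro N _ _ hb ha
    obtain ⟨E, _, _, C, _, _, f, g, _, hf, hg, hfg⟩ := exists_seq' (R := R) N
    obtain ⟨h1, h2, h3⟩ := gmap_props b f g hfg hf hg (hb 0)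
    rw [shift f g hfg hf hg]
    rw [shift _ _ h3 h1 h2] at ha
    exact ih C (fun j => (shift f g hfg hf hg).1 (hb (j + 1))) ha

/-- the sum lemma -/
lemma sum (a b c : Ideal R) (s : ℕ) (H : ∀ (N : Type) [AddCommGroup N] [Module R N]
    (_ : ∀ z : N, Tor c z) (i : ℕ), s < i → LCV a i N) (t : ℕ) :
    ∀ (N : Type) [AddCommGroup N] [Module R N] (_ : ∀ z : N, Tor c z)
      (_ : ∀ j, t < j → LCV b j N) (i : ℕ), s + t < i → LCV (a ⊔ b) i N := by
  induction t with
  | zero =>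
    intro N _ _ hN hb i hi
    obtain ⟨i, rfl⟩ : ∃ k, i = k + 1 := ⟨i - 1, by omega⟩
    refine sum_zero a b i N (fun j => hb _ (by omega)) (H _ (fun z => ?_) _ (by omega))
    exact Tor.of_map (Gam b N).subtype (Submodule.subtype_injective _) (hN z)
  | succ t ih =>
    intro N _ _ hN hb i hi
    obtain ⟨i, rfl⟩ : ∃ k, i = k + 2 := ⟨i - 2, by omega⟩
    obtain ⟨E, _, _, C, _, _, f, g, _, hf, hg, hfg, hE, hC⟩ := exists_seq c hN
    rw [shift f g hfg hf hg]
    refine ih C hC (fun j hj => ?_) _ (by omega)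
    obtain ⟨j, rfl⟩ : ∃ k, j = k + 1 := ⟨j - 1, by omega⟩
    exact (shift f g hfg hf hg).1 (hb _ (by omega))

lemma up (a : Ideal R) (T : ℕ) (H : ∀ (N : Type) [AddCommGroup N] [Module R N],
    LCV a (T + 1) N) (N : Type) [AddCommGroup N] [Module R N] (i : ℕ) (hi : T < i) : LCV a i N := by
  obtain ⟨k, rfl⟩ : ∃ k, i = T + 1 + k := ⟨i - (T + 1), by omega⟩
  clear hi
  induction k generalizing N with
  | zero => exact H N
  | succ k ih =>
    obtain ⟨E, _, _, C, _, _, f, g, _, hf, hg, hfg⟩ := exists_seq' (R := R) N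
    have : T + 1 + (k + 1) = (T + k) + 2 := by omega
    rw [this, shift f g hfg hf hg]
    have : T + k + 1 = T + 1 + k := by omega
    rw [this]
    exact ih C

lemma bot_one (N : Type) [AddCommGroup N] [Module R N] : LCV (⊥ : Ideal R) 1 N := by
  obtain ⟨E, _, _, C, _, _, f, g, _, hf, hg, hfg⟩ := exists_seq' (R := R) N
  rw [one f g hfg hf hg]
  intro z _
  obtain ⟨e, he⟩ := hg z
  exact ⟨e, Tor.bot e, he⟩

lemma exists_ann (x : R) (n : ℕ) : ∃ k, ∀ r : R, x ^ (k + n) * r = 0 → x ^ k * r = 0 := by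
  let F : ℕ →o Ideal R := ⟨fun k => LinearMap.ker (LinearMap.mulLeft R (x ^ k)), by
    intro k l hkl r hr
    simp only [LinearMap.mem_ker, LinearMap.mulLeft_apply] at hr ⊢
    obtain ⟨d, rfl⟩ := Nat.exists_eq_add_of_le hkl
    rw [pow_add, mul_right_comm, hr, zero_mul]⟩
  obtain ⟨k, hk⟩ := monotone_stabilizes_iff_noetherian.2 (inferInstance : IsNoetherian R R) F
  refine ⟨k, fun r hr => ?_⟩
  have : r ∈ F (k + n) := hr
  rw [← hk (k + n) (by omega)] at this
  exact this

lemma principal_two (x : R) (N : Type) [AddCommGroup N] [Module R N] :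
    LCV (Ideal.span {x}) 2 N := by
  obtain ⟨E, _, _, C, _, _, f, g, _, hf, hg, hfg⟩ := exists_seq' (R := R) N
  rw [shift f g hfg hf hg]
  obtain ⟨E', _, _, C', _, _, f', g', _, hf', hg', hfg'⟩ := exists_seq' (R := R) C
  rw [one f' g' hfg' hf' hg']
  intro z hz
  obtain ⟨n, hn⟩ := hz.exists_pow
  obtain ⟨e', rfl⟩ := hg' z
  have h1 : g' (x ^ n • e') = 0 := by
    rw [map_smul]; exact hn _ (Ideal.pow_mem_pow (Ideal.mem_span_singleton_self x) n)
  obtain ⟨c, hc⟩ := (hfg' _).1 h1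
  obtain ⟨e, rfl⟩ := hg c
  obtain ⟨k, hk⟩ := exists_ann x n
  -- solve `x ^ (k + n) • e1 = x ^ k • e`
  obtain ⟨φ, hφ⟩ := Module.Injective.out (LinearMap.range (LinearMap.mulLeft R (x ^ (k + n)))).subtype
    (Submodule.subtype_injective _)
    ((Submodule.liftQ (LinearMap.ker (LinearMap.mulLeft R (x ^ (k + n))))
      (LinearMap.toSpanSingleton R E (x ^ k • e)) (by
        intro r hr
        have := hk r hr
        simp only [LinearMap.mem_ker, LinearMap.toSpanSingleton_apply]
        rw [smul_smul, mul_comm, this, zero_smul])) ∘ₗ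
      (LinearMap.quotKerEquivRange (LinearMap.mulLeft R (x ^ (k + n)))).symm.toLinearMap)
  have h2 : x ^ (k + n) • φ 1 = x ^ k • e := by
    have h3 := hφ (LinearMap.quotKerEquivRange (LinearMap.mulLeft R (x ^ (k + n)))
      (Submodule.Quotient.mk 1))
    rw [LinearMap.comp_apply, LinearEquiv.coe_coe, LinearEquiv.symm_apply_apply,
      Submodule.liftQ_apply] at h3
    rw [← map_smul]
    exact h3.trans (by simp)
  refine ⟨e' - f' (g (φ 1)), Tor.of_pow (k + n) ?_, ?_⟩
  · intro r hr
    rw [Ideal.span_singleton_pow, Ideal.mem_span_singleton'] at hr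
    obtain ⟨s, rfl⟩ := hr
    rw [mul_smul, smul_sub, ← map_smul, ← map_smul, h2, pow_add, mul_smul, ← hc, ← map_smul,
      ← map_smul, sub_self, smul_zero]
  · rw [map_sub, hfg'.apply_apply_eq_zero, sub_zero]

lemma bounded (a : Ideal R) : ∃ T, ∀ (N : Type) [AddCommGroup N] [Module R N] (i : ℕ),
    T < i → LCV a i N := by
  induction a, IsNoetherian.noetherian a using Submodule.fg_induction with
  | singleton x => exact ⟨1, fun N _ _ i hi => up _ 1 (fun N _ _ => principal_two x N) N i hi⟩
  | sup a b _ _ ha hb =>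
    obtain ⟨s, hs⟩ := ha
    obtain ⟨t, ht⟩ := hb
    exact ⟨s + t, fun N _ _ i hi => sum a b ⊥ s (fun N _ _ _ => hs N) t N Tor.bot (ht N) i hi⟩

/-- Mayer-Vietoris, splitting of torsion elements in an injective module -/
lemma split (a b : Ideal R) {E : Type} [AddCommGroup E] [Module R E] [Module.Injective R E] (z : E)
    (hz : Tor (a ⊓ b) z) : ∃ e : E, Tor a e ∧ Tor b (z - e) := by
  obtain ⟨n, hn⟩ := hz.exists_pow
  obtain ⟨m, hm⟩ := artin_rees a (b ^ n) n
  have h0 : ∀ r ∈ b ^ n, r ∈ a ^ m → r • z = 0 := by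
    intro r h1 h2
    refine hn r ?_
    have h3 := hm ⟨h2, h1⟩
    rw [smul_eq_mul, ← mul_pow] at h3
    exact Ideal.pow_right_mono Ideal.mul_le_inf n h3
  obtain ⟨e, h1, h2⟩ := ext_kill (b ^ n) (a ^ m) ((LinearMap.toSpanSingleton R E z) ∘ₗ
    (b ^ n).subtype) (fun r h h' => h0 r h h')
  refine ⟨e, Tor.of_pow m h1, Tor.of_pow n fun r hr => ?_⟩
  rw [smul_sub, h2 r hr]
  simp

lemma mv_one (a b : Ideal R) (N : Type) [AddCommGroup N] [Module R N] (ha : LCV a 1 N)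
    (hb : LCV b 1 N) (hab : LCV (a ⊔ b) 2 N) : LCV (a ⊓ b) 1 N := by
  obtain ⟨E, _, _, C, _, _, f, g, _, hf, hg, hfg⟩ := exists_seq' (R := R) N
  obtain ⟨E', _, _, C', _, _, f', g', _, hf', hg', hfg'⟩ := exists_seq' (R := R) C
  rw [shift f g hfg hf hg, one f' g' hfg' hf' hg'] at hab
  rw [one f g hfg hf hg] at *
  intro z hz
  obtain ⟨e1, h1, h2⟩ := split a b (f' z) (hz.map f')
  have h3 : Tor b (g' e1) := by
    have := h2.map g'
    rw [map_sub, hfg'.apply_apply_eq_zero, zero_sub] at this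
    simpa using this.smul (-1)
  obtain ⟨e3, h4, h5⟩ := hab (g' e1) ((h1.map g').sup h3)
  obtain ⟨c, hc⟩ := (hfg' (e1 - e3)).1 (by rw [map_sub, h5, sub_self])
  have hca : Tor a c := by
    refine Tor.of_map f' hf' ?_
    rw [hc, sub_eq_add_neg]
    exact h1.add (by simpa using (h4.mono le_sup_left).smul (-1))
  have hcb : Tor b (z - c) := by
    refine Tor.of_map f' hf' ?_
    have : f' (z - c) = (f' z - e1) + e3 := by rw [map_sub, hc]; abel
    rw [this]
    exact h2.add (h4.mono le_sup_right)
  obtain ⟨p, hp, hp'⟩ := ha c hca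
  obtain ⟨q, hq, hq'⟩ := hb _ hcb
  exact ⟨p + q, (hp.mono inf_le_left).add (hq.mono inf_le_right), by rw [map_add, hp', hq']; abel⟩

lemma mv (a b : Ideal R) (i : ℕ) : ∀ (N : Type) [AddCommGroup N] [Module R N]
    (_ : LCV a (i + 1) N) (_ : LCV b (i + 1) N) (_ : LCV (a ⊔ b) (i + 2) N),
    LCV (a ⊓ b) (i + 1) N := by
  induction i with
  | zero => exact mv_one a b
  | succ i ih =>
    intro N _ _ ha hb hab
    obtain ⟨E, _, _, C, _, _, f, g, _, hf, hg, hfg⟩ := exists_seq' (R := R) N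
    rw [shift f g hfg hf hg] at *
    exact ih C ha hb hab

end Bounds

end LCV

namespace LCV

section FG

variable {R : Type} [CommRing R] [IsNoetherianRing R]

lemma fg_class (N : Type) [AddCommGroup N] [Module R N] (i : ℕ) :
    ∀ (X : Type) [AddCommGroup X] [Module R X] [Module.Finite R X]
      (x : Abelian.Ext (ModuleCat.of R X) (ModuleCat.of R N) i),
      ∃ N₀ : Submodule R N, N₀.FG ∧ ∃ y : Abelian.Ext (ModuleCat.of R X) (ModuleCat.of R N₀) i,
        y.comp (Abelian.Ext.mk₀ (ModuleCat.ofHom N₀.subtype)) (add_zero i) = x := by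
  induction i with
  | zero =>
    intro X _ _ _ x
    obtain ⟨φ, rfl⟩ := Abelian.Ext.addEquiv₀.symm.surjective x
    refine ⟨LinearMap.range φ.hom, ?_, Abelian.Ext.mk₀ (ModuleCat.ofHom φ.hom.rangeRestrict), ?_⟩
    · exact Module.Finite.iff_fg.1 inferInstance
    · rw [Abelian.Ext.mk₀_comp_mk₀, Abelian.Ext.addEquiv₀_symm_apply]
      rfl
  | succ i ih =>
    intro X _ _ _ x
    obtain ⟨k, π, hπ⟩ := Module.Finite.exists_fin' R X
    have hex : Function.Exact (LinearMap.ker π).subtype π := LinearMap.exact_subtype_ker_map π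
    have S := sc_exact (LinearMap.ker π).subtype π hex (Submodule.subtype_injective _) hπ
    have hp : Projective (sc (LinearMap.ker π).subtype π hex).X₂ :=
      (IsProjective.iff_projective (Fin k → R)).1 inferInstance
    obtain ⟨x', hx'⟩ := Abelian.Ext.contravariant_sequence_exact₃ S (ModuleCat.of R N) x
      (Abelian.Ext.eq_zero_of_projective _) (add_comm 1 i)
    obtain ⟨N₀, hN₀, y, hy⟩ := ih (LinearMap.ker π) x'
    refine ⟨N₀, hN₀, S.extClass.comp y (add_comm 1 i), ?_⟩
    have e1 := Abelian.Ext.comp_assoc_of_third_deg_zero S.extClass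
      (show Abelian.Ext (sc (LinearMap.ker π).subtype π hex).X₁ (ModuleCat.of R N₀) i from y)
      (Abelian.Ext.mk₀ (ModuleCat.ofHom N₀.subtype)) (add_comm 1 i)
    exact e1.trans ((congrArg (fun w => S.extClass.comp w (add_comm 1 i)) hy).trans hx')

lemma of_fg {a : Ideal R} {i : ℕ} {N : Type} [AddCommGroup N] [Module R N]
    (H : ∀ N₀ : Submodule R N, N₀.FG → LCV a i N₀) : LCV a i N := by
  intro J hJ x
  obtain ⟨N₀, h, y, rfl⟩ := fg_class N i (R ⧸ J) x
  obtain ⟨J', hJ', h1, h2⟩ := H N₀ h J hJ y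
  refine ⟨J', hJ', h1, ?_⟩
  rw [← Abelian.Ext.comp_assoc_of_third_deg_zero, h2]
  simp

end FG

section Support

variable {R : Type} [CommRing R] [IsNoetherianRing R]

open TensorProduct in
lemma exists_map (M : Type) [AddCommGroup M] [Module R M] [Module.Finite R M] (q : Ideal R)
    [hq : q.IsPrime] (h : Module.annihilator R M ≤ q) : ∃ φ : M →ₗ[R] R ⧸ q, φ ≠ 0 := by
  have hs : (⟨q, hq⟩ : PrimeSpectrum R) ∈ Module.support R M := by
    rw [Module.support_eq_zeroLocus]; exact h
  rw [Module.mem_support_iff_nontrivial_residueField_tensorProduct] at hs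
  change Nontrivial (q.ResidueField ⊗[R] M) at hs
  obtain ⟨m, hm⟩ : ∃ m : M, (1 : q.ResidueField) ⊗ₜ[R] m ≠ 0 := by
    by_contra! hc
    obtain ⟨v, hv⟩ := exists_ne (0 : q.ResidueField ⊗[R] M)
    apply hv
    induction v using TensorProduct.induction_on with
    | zero => rfl
    | tmul x y =>
      have : x ⊗ₜ[R] y = x • ((1 : q.ResidueField) ⊗ₜ[R] y) := by
        rw [TensorProduct.smul_tmul', smul_eq_mul, mul_one]
      rw [this, hc, smul_zero]
    | add x y hx hy =>
      by_cases h1 : x = 0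
      · by_cases h2 : y = 0
        · rw [h1, h2, add_zero]
        · exact absurd (hy h2) h2
      · exact absurd (hx h1) h1
  obtain ⟨ψ, hψ⟩ : ∃ ψ : Module.Dual q.ResidueField (q.ResidueField ⊗[R] M),
      ψ ((1 : q.ResidueField) ⊗ₜ[R] m) ≠ 0 := by
    by_contra! hc
    exact hm ((Module.forall_dual_apply_eq_zero_iff q.ResidueField _).1 hc)
  let f : M →ₗ[R] q.ResidueField := (ψ.restrictScalars R) ∘ₗ (TensorProduct.mk R q.ResidueField M 1)
  have hfm : f m ≠ 0 := hψ
  obtain ⟨s, hs⟩ := (Module.Finite.fg_top : (⊤ : Submodule R M).FG)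
  classical
  obtain ⟨d, hd⟩ := IsLocalization.exist_integer_multiples_of_finset (nonZeroDivisors (R ⧸ q))
    (s.image f)
  let alg : (R ⧸ q) →ₗ[R] q.ResidueField := (Algebra.linearMap (R ⧸ q) q.ResidueField).restrictScalars R
  have halg : Function.Injective alg := IsFractionRing.injective (R ⧸ q) q.ResidueField
  let μ : q.ResidueField →ₗ[R] q.ResidueField :=
    (LinearMap.mulLeft q.ResidueField (algebraMap (R ⧸ q) q.ResidueField d)).restrictScalars R
  have hμ : ∀ x, μ x = algebraMap (R ⧸ q) q.ResidueField d * x := fun x => rfl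
  have hr : ∀ x : M, (μ ∘ₗ f) x ∈ LinearMap.range alg := by
    intro x
    have hx : x ∈ Submodule.span R (s : Set M) := by rw [hs]; trivial
    induction hx using Submodule.span_induction with
    | mem x hx =>
      obtain ⟨r, hr⟩ := hd (f x) (Finset.mem_image_of_mem f hx)
      refine ⟨r, ?_⟩
      change algebraMap _ _ r = _
      exact hr.trans (Algebra.smul_def _ _)
    | zero => rw [map_zero]; exact Submodule.zero_mem _
    | add x y _ _ hx hy => rw [map_add]; exact Submodule.add_mem _ hx hy
    | smul t x _ hx => rw [map_smul]; exact Submodule.smul_mem _ _ hx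
  refine ⟨(LinearEquiv.ofInjective alg halg).symm.toLinearMap ∘ₗ
    LinearMap.codRestrict (LinearMap.range alg) (μ ∘ₗ f) hr, fun h0 => ?_⟩
  have h1 := LinearMap.congr_fun h0 m
  simp only [LinearMap.comp_apply, LinearEquiv.coe_coe, LinearMap.zero_apply,
    LinearEquiv.map_eq_zero_iff] at h1
  have h2 : μ (f m) = 0 := congrArg Subtype.val h1
  rw [hμ, mul_eq_zero] at h2
  rcases h2 with h2 | h2
  · have : (d : R ⧸ q) = 0 := halg (h2.trans (map_zero alg).symm)
    exact nonZeroDivisors.coe_ne_zero d this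
  · exact hfm h2

lemma tor_sub {c : Ideal R} {N N' : Type} [AddCommGroup N] [Module R N] [AddCommGroup N']
    [Module R N'] (f : N →ₗ[R] N') (hf : Function.Injective f) (h : ∀ z : N', Tor c z) (z : N) :
    Tor c z := Tor.of_map f hf (h _)

lemma tor_quot {c : Ideal R} {N N' : Type} [AddCommGroup N] [Module R N] [AddCommGroup N']
    [Module R N'] (f : N →ₗ[R] N') (hf : Function.Surjective f) (h : ∀ z : N, Tor c z) (z : N') :
    Tor c z := by
  obtain ⟨w, rfl⟩ := hf z
  exact (h w).map f

lemma tor_self (M : Type) [AddCommGroup M] [Module R M] (z : M) :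
    Tor (Module.annihilator R M) z :=
  ⟨Module.annihilator R M, Ideal.le_radical, fun _ hr => Module.mem_annihilator.1 hr z⟩

lemma gruson_step {a : Ideal R} {i : ℕ} (M : Type) [AddCommGroup M] [Module R M]
    [Module.Finite R M] (hM : LCV a i M)
    (Hup : ∀ (N : Type) [AddCommGroup N] [Module R N],
      (∀ z : N, Tor (Module.annihilator R M) z) → LCV a (i + 1) N) (I : Ideal R) :
    ∀ (N : Type) [AddCommGroup N] [Module R N] [Module.Finite R N],
      (∀ z : N, Tor (Module.annihilator R M) z) → I ≤ Module.annihilator R N → LCV a i N := by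
  induction I using WellFoundedGT.induction with
  | ind I ih =>
  intro N _ _ hfin hN hI
  induction hfin using IsNoetherianRing.induction_on_isQuotientEquivQuotientPrime R with
  | subsingleton N => exact of_subsingleton
  | exact N₁ N₂ N₃ f g hf hg hfg h₁ h₃ =>
    refine mid f g hfg hf hg (h₁ (tor_sub f hf hN) (hI.trans (LinearMap.annihilator_le_of_injective f hf)))
      (h₃ (tor_quot g hg hN) (hI.trans (LinearMap.annihilator_le_of_surjective g hg)))
  | quotient N p e =>
    obtain ⟨q, hq⟩ := p
    change N ≃ₗ[R] R ⧸ q at e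
    have hI' : I ≤ q := by
      rw [e.annihilator_eq, Ideal.annihilator_quotient] at hI
      exact hI
    rcases hI'.lt_or_eq with hlt | rfl
    · exact ih q hlt N hN (by rw [e.annihilator_eq, Ideal.annihilator_quotient])
    refine of_equiv e.symm ?_
    have hR : ∀ z : R ⧸ I, Tor (Module.annihilator R M) z := tor_quot e.toLinearMap e.surjective hN
    have hc : Module.annihilator R M ≤ I := by
      obtain ⟨J, h1, h2⟩ := hR (Ideal.Quotient.mk I 1)
      refine h1.trans (hq.radical_le_iff.2 fun r hr => ?_)
      have := h2 r hr
      rw [← Ideal.Quotient.eq_zero_iff_mem]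
      simpa [Algebra.smul_def] using this
    obtain ⟨h, hh⟩ := exists_map M I hc
    have him : LCV a i (LinearMap.range h) :=
      right (LinearMap.ker h).subtype h.rangeRestrict
        (by
          intro x
          simp [LinearMap.rangeRestrict, Subtype.ext_iff])
        (Submodule.subtype_injective _) h.surjective_rangeRestrict hM
        (Hup _ (tor_sub _ (Submodule.subtype_injective _) (tor_self M)))
    refine mid (LinearMap.range h).subtype (LinearMap.range h).mkQ
      (LinearMap.exact_subtype_mkQ _) (Submodule.subtype_injective _)
      (Submodule.mkQ_surjective _) him ?_
    refine ih (Submodule.comap (Submodule.mkQ I) (LinearMap.range h)) ?_ _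
      (tor_quot _ (Submodule.mkQ_surjective _) hR) ?_
    · refine lt_of_le_of_ne ?_ ?_
      · intro r hr
        rw [Submodule.mem_comap, Submodule.mkQ_apply, (Submodule.Quotient.mk_eq_zero _).2 hr]
        exact Submodule.zero_mem _
      · intro heq
        apply hh
        ext m
        obtain ⟨r, hr⟩ := Submodule.mkQ_surjective I (h m)
        have : r ∈ Submodule.comap (Submodule.mkQ I) (LinearMap.range h) := ⟨m, hr.symm⟩
        rw [← heq] at this
        rw [← hr, Submodule.mkQ_apply, (Submodule.Quotient.mk_eq_zero _).2 this]
        rfl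
    · intro r hr
      rw [Module.mem_annihilator]
      intro z
      obtain ⟨w, rfl⟩ := Submodule.mkQ_surjective _ z
      obtain ⟨s, rfl⟩ := Submodule.mkQ_surjective _ w
      rw [← map_smul, Submodule.mkQ_apply, Submodule.Quotient.mk_eq_zero, ← map_smul, smul_eq_mul,
        mul_comm, ← smul_eq_mul, map_smul]
      exact Submodule.smul_mem _ _ hr

lemma gruson {a : Ideal R} {s : ℕ} (M : Type) [AddCommGroup M] [Module R M]
    [Module.Finite R M] (hM : ∀ i, s < i → LCV a i M) (N : Type) [AddCommGroup N] [Module R N]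
    (hN : ∀ z : N, Tor (Module.annihilator R M) z) (i : ℕ) (hi : s < i) : LCV a i N := by
  obtain ⟨T, hT⟩ := bounded a
  suffices H : ∀ d i, s < i → T < i + d → ∀ (N : Type) [AddCommGroup N] [Module R N],
      (∀ z : N, Tor (Module.annihilator R M) z) → LCV a i N from H (T + 1) i hi (by omega) N hN
  intro d
  induction d with
  | zero => intro i _ h N _ _ _; exact hT N i (by omega)
  | succ d ih =>
    intro i hi h N _ _ hN
    refine of_fg fun N₀ hN₀ => ?_
    have : Module.Finite R N₀ := Module.Finite.iff_fg.2 hN₀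
    exact gruson_step M (hM i hi) (ih (i + 1) (by omega) (by omega)) ⊥ N₀
      (tor_sub _ (Submodule.subtype_injective _) hN) bot_le

end Support

section Main

variable {R : Type} [CommRing R] [IsNoetherianRing R]

lemma inf_finset (c : Ideal R) (t : Ideal R → ℕ) (S : Finset (Ideal R))
    (H : ∀ p ∈ S, ∀ (N : Type) [AddCommGroup N] [Module R N], (∀ z : N, Tor c z) →
      ∀ i, t p < i → LCV p i N) :
    ∀ (N : Type) [AddCommGroup N] [Module R N], (∀ z : N, Tor c z) →
      ∀ i, ∑ p ∈ S, t p < i → LCV (S.inf id) i N := by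
  classical
  induction S using Finset.induction_on with
  | empty => intro N _ _ _ i _; exact top
  | insert p S hp ih =>
    intro N _ _ hN i hi
    rw [Finset.sum_insert hp] at hi
    rw [Finset.inf_insert]
    have ih := ih (fun q hq => H q (Finset.mem_insert_of_mem hq))
    have hp' := H p (Finset.mem_insert_self _ _)
    obtain ⟨i, rfl⟩ : ∃ k, i = k + 1 := ⟨i - 1, by omega⟩
    exact mv _ _ i N (hp' N hN _ (by omega)) (ih N hN _ (by omega))
      (sum p _ c (t p) (fun N _ _ => hp' N) _ N hN (ih N hN) _ (by omega))

end Main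

end LCV

lemma LCV.cohDim_spec {R : Type} [CommRing R] [IsNoetherianRing R] (p : Ideal R) (M : ModuleCat R)
    (i : ℕ) (hi : cohDim p M < i) : LCV p i M := by
  obtain ⟨T, hT⟩ := LCV.bounded p
  obtain ⟨k, rfl⟩ : ∃ k, i = k + 1 := ⟨i - 1, by omega⟩
  refine (LCV.subsingleton_iff p k M).1 ?_
  by_contra hc
  rw [not_subsingleton_iff_nontrivial] at hc
  have hb : BddAbove {i : ℕ | Nontrivial ((localCohomology p i).obj M)} := by
    refine ⟨T, fun j hj => ?_⟩
    by_contra hlt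
    obtain ⟨l, rfl⟩ : ∃ l, j = l + 1 := ⟨j - 1, by omega⟩
    exact not_subsingleton_iff_nontrivial.2 hj
      ((LCV.subsingleton_iff p l M).2 (hT M (l + 1) (by omega)))
  exact absurd (le_csSup hb hc) (not_le.2 hi)



/-- Let `R` be a commutative noetherian ring, `a` a proper ideal of `R` and `M`
a finitely generated `R`-module.  Then `cd(a, M) ≤ Σ_{p ∈ Min(a)} cd(p, M)`, where `Min(a)` is
the (finite) set of minimal primes over `a`.  (The sum is stated as a `finsum` over the set
`a.minimalPrimes`, which is finite since `R` is noetherian.) -/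
theorem statement3 {R : Type} [CommRing R] [IsNoetherianRing R] (a : Ideal R) (ha : a ≠ ⊤)
    (M : ModuleCat R) [Module.Finite R M] :
    cohDim a M ≤ ∑ᶠ p ∈ a.minimalPrimes, cohDim p M := by
  have hfin := Ideal.finite_minimalPrimes_of_isNoetherianRing R a
  rw [finsum_mem_eq_finite_toFinset_sum _ hfin]
  have key := LCV.inf_finset (Module.annihilator R M) (fun p => cohDim p M) hfin.toFinset
    (fun p _ N _ _ hN i hi => LCV.gruson M (LCV.cohDim_spec p M) N hN i hi) M (LCV.tor_self M)
  refine csSup_le' fun i hi => ?_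
  by_contra hlt
  rw [not_le] at hlt
  have h1 := key i hlt
  have h2 : hfin.toFinset.inf id = a.radical := by
    rw [Finset.inf_id_eq_sInf, hfin.coe_toFinset, Ideal.sInf_minimalPrimes]
  rw [h2] at h1
  have h3 : LCV a i M := LCV.of_radical (Ideal.radical_idem a) h1
  obtain ⟨k, rfl⟩ : ∃ k, i = k + 1 := ⟨i - 1, by omega⟩
  exact not_subsingleton_iff_nontrivial.2 hi ((LCV.subsingleton_iff a k M).2 h3)
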